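/- arXiv:2004.00684 — 2 statements merged into one kernel-verified Lean document; each statement's English description precedes it below -/
import Mathlib

section
/- For all integers n ≥ 0 and k ≥ 1, the number of lattice paths of length 2n that stay in the strip [-k-1, k] and end at height 0 is equal to the number of lattice paths of length 2n that stay in the strip [0, 2k+1] (with no restriction on the final height). -/
/-- The height of a lattice path `s : Fin n → ℤ` after `j` steps:
the sum of the first `j` steps. -/
def pathHeight {n : ℕ} (s : Fin n → ℤ) (j : ℕ) : ℤ :=
  ∑ i ∈ Finset.univ.filter (fun i : Fin n => (i : ℕ) < j), s i

/-- The number of lattice paths of length `n` (steps `±1`) whose height stays in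
`[a, b]` at every time `0 ≤ j ≤ n` and whose final height lies in `E`. -/
noncomputable def pathCount (n : ℕ) (a b : ℤ) (E : Set ℤ) : ℕ :=
  Nat.card {s : Fin n → ℤ //
    (∀ i, s i ∈ ({1, -1} : Set ℤ)) ∧
    (∀ j ≤ n, pathHeight s j ∈ Set.Icc a b) ∧
    pathHeight s n ∈ E}

/-- The number of walks on `ℤ` with `n` steps `±1` from `x` to `y` that stay in `[a, b]`. -/
def stripWalks (a b : ℤ) : ℕ → ℤ → ℤ → ℕ
  | 0, x, y => if a ≤ x ∧ x ≤ b ∧ x = y then 1 else 0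
  | n + 1, x, y =>
    if a ≤ x ∧ x ≤ b then stripWalks a b n (x - 1) y + stripWalks a b n (x + 1) y else 0

/-- The lattice paths of length `n` which, started at height `x`, stay in `[a, b]` and end
in `E`. -/
def stripPaths (n : ℕ) (a b x : ℤ) (E : Set ℤ) : Set (Fin n → ℤ) :=
  {s | (∀ i, s i ∈ ({1, -1} : Set ℤ)) ∧
    (∀ j ≤ n, x + pathHeight s j ∈ Set.Icc a b) ∧ x + pathHeight s n ∈ E}

lemma pathHeight_zero {n : ℕ} (s : Fin n → ℤ) : pathHeight s 0 = 0 := by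
  simp [pathHeight]

lemma pathHeight_cons {n : ℕ} (c : ℤ) (s : Fin n → ℤ) (j : ℕ) :
    pathHeight (Fin.cons c s : Fin (n + 1) → ℤ) (j + 1) = c + pathHeight s j := by
  simp [pathHeight, Finset.sum_filter, Fin.sum_univ_succ]

lemma stripPaths_finite (n : ℕ) (a b x : ℤ) (E : Set ℤ) : (stripPaths n a b x E).Finite :=
  (Set.Finite.pi' (t := fun _ : Fin n => ({1, -1} : Set ℤ)) fun _ => Set.toFinite _).subset
    fun _ hs => hs.1

lemma cons_mem_stripPaths {n : ℕ} {a b x c : ℤ} {E : Set ℤ} {s : Fin n → ℤ} :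
    (Fin.cons c s : Fin (n + 1) → ℤ) ∈ stripPaths (n + 1) a b x E ↔
      c ∈ ({1, -1} : Set ℤ) ∧ x ∈ Set.Icc a b ∧ s ∈ stripPaths n a b (x + c) E := by
  simp only [stripPaths, Set.mem_ofPred_eq, Fin.forall_fin_succ, Fin.cons_zero, Fin.cons_succ,
    pathHeight_cons, ← add_assoc]
  constructor
  · rintro ⟨⟨hc, hs⟩, hj, hE⟩
    refine ⟨hc, ?_, hs, fun j hjn => ?_, hE⟩
    · simpa [pathHeight_zero] using hj 0 (Nat.zero_le _)
    · simpa [pathHeight_cons, ← add_assoc] using hj (j + 1) (by omega)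
  · rintro ⟨hc, hx, hs, hj, hE⟩
    refine ⟨⟨hc, hs⟩, fun j hjn => ?_, hE⟩
    cases j with
    | zero => simpa [pathHeight_zero] using hx
    | succ j => simpa [pathHeight_cons, ← add_assoc] using hj j (by omega)

lemma stripPaths_succ {n : ℕ} {a b x : ℤ} {E : Set ℤ} (hx : x ∈ Set.Icc a b) :
    stripPaths (n + 1) a b x E =
      (fun s : Fin n → ℤ => (Fin.cons (-1) s : Fin (n + 1) → ℤ)) '' stripPaths n a b (x - 1) E ∪
        (fun s : Fin n → ℤ => (Fin.cons 1 s : Fin (n + 1) → ℤ)) '' stripPaths n a b (x + 1) E := by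
  ext s
  constructor
  · intro hs
    rw [← Fin.cons_self_tail s, cons_mem_stripPaths] at hs
    obtain ⟨hc | hc, -, ht⟩ := hs
    · refine Or.inr ⟨Fin.tail s, by rwa [hc] at ht, ?_⟩
      simp only [← hc, Fin.cons_self_tail]
    · rw [Set.mem_singleton_iff] at hc
      refine Or.inl ⟨Fin.tail s, by rwa [hc] at ht, ?_⟩
      simp only [← hc, Fin.cons_self_tail]
  · rintro (⟨t, ht, rfl⟩ | ⟨t, ht, rfl⟩)
    · exact cons_mem_stripPaths.2 ⟨by simp, hx, ht⟩
    · exact cons_mem_stripPaths.2 ⟨by simp, hx, ht⟩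

lemma ncard_stripPaths (a b : ℤ) (E : Set ℤ) [DecidablePred (· ∈ E)] (n : ℕ) (x : ℤ) :
    (stripPaths n a b x E).ncard =
      ∑ y ∈ (Finset.Icc a b).filter (· ∈ E), stripWalks a b n x y := by
  induction n generalizing x with
  | zero =>
    by_cases h : x ∈ Set.Icc a b ∧ x ∈ E
    · have hs : stripPaths 0 a b x E = {Fin.elim0} := by
        ext s
        simp [stripPaths, pathHeight_zero, h.1.1, h.1.2, h.2, Subsingleton.elim s Fin.elim0]
      rw [hs, Set.ncard_singleton, Finset.sum_eq_single x]
      · simp [stripWalks, h.1.1, h.1.2]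
      · intro y _ hy
        simp [stripWalks, hy.symm]
      · simp [h.1.1, h.1.2, h.2]
    · have hs : stripPaths 0 a b x E = ∅ := by
        ext s
        simp only [stripPaths, Set.mem_ofPred_eq, Set.mem_empty_iff_false, iff_false]
        rintro ⟨-, h1, h2⟩
        exact h ⟨by simpa [pathHeight_zero] using h1 0 le_rfl,
          by simpa [pathHeight_zero] using h2⟩
      rw [hs, Set.ncard_empty, eq_comm]
      refine Finset.sum_eq_zero fun y hy => ?_
      rw [stripWalks, if_neg]
      rintro ⟨h1, h2, rfl⟩
      exact h ⟨⟨h1, h2⟩, (Finset.mem_filter.1 hy).2⟩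
  | succ n ih =>
    by_cases hx : x ∈ Set.Icc a b
    · have hinj (c : ℤ) :
          Function.Injective fun s : Fin n → ℤ => (Fin.cons c s : Fin (n + 1) → ℤ) :=
        Fin.cons_right_injective (α := fun _ => ℤ) c
      rw [stripPaths_succ hx, Set.ncard_union_eq _ ((stripPaths_finite ..).image _)
        ((stripPaths_finite ..).image _),
        Set.ncard_image_of_injective _ (hinj (-1)),
        Set.ncard_image_of_injective _ (hinj 1), ih, ih,
        ← Finset.sum_add_distrib]
      · exact Finset.sum_congr rfl fun y _ => (if_pos hx).symm
      · rw [Set.disjoint_left]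
        rintro _ ⟨s, -, rfl⟩ ⟨t, -, h⟩
        have := congrFun h 0
        simp at this
    · have hs : stripPaths (n + 1) a b x E = ∅ := by
        ext s
        simp only [Set.mem_empty_iff_false, iff_false]
        intro h
        exact hx (by simpa [pathHeight_zero] using h.2.1 0 (Nat.zero_le _))
      rw [hs, Set.ncard_empty, eq_comm]
      exact Finset.sum_eq_zero fun y _ => if_neg hx

lemma pathCount_eq_sum_stripWalks (n : ℕ) (a b : ℤ) (E : Set ℤ) [DecidablePred (· ∈ E)] :
    pathCount n a b E = ∑ y ∈ (Finset.Icc a b).filter (· ∈ E), stripWalks a b n 0 y := by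
  rw [← ncard_stripPaths, ← Nat.card_coe_set_eq]
  simp only [pathCount, stripPaths, zero_add]
  rfl

lemma stripWalks_add (a b c : ℤ) (n : ℕ) (x y : ℤ) :
    stripWalks (a + c) (b + c) n (x + c) (y + c) = stripWalks a b n x y := by
  induction n generalizing x with
  | zero => simp [stripWalks]
  | succ n ih =>
    simp only [stripWalks, add_le_add_iff_right]
    rw [← ih (x - 1), ← ih (x + 1), sub_add_eq_add_sub, add_right_comm]

lemma stripWalks_eq_zero_left {a b x : ℤ} (hx : ¬(a ≤ x ∧ x ≤ b)) (n : ℕ) (y : ℤ) :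
    stripWalks a b n x y = 0 := by
  cases n with
  | zero => exact if_neg fun h => hx ⟨h.1, h.2.1⟩
  | succ n => exact if_neg hx

lemma stripWalks_eq_zero_right {a b y : ℤ} (hy : ¬(a ≤ y ∧ y ≤ b)) (n : ℕ) (x : ℤ) :
    stripWalks a b n x y = 0 := by
  induction n generalizing x with
  | zero =>
    refine if_neg ?_
    rintro ⟨h1, h2, rfl⟩
    exact hy ⟨h1, h2⟩
  | succ n ih => simp [stripWalks, ih]

lemma stripWalks_eq_zero_of_odd {a b : ℤ} {n : ℕ} {x y : ℤ} (h : Odd (n + x + y)) :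
    stripWalks a b n x y = 0 := by
  induction n generalizing x with
  | zero =>
    refine if_neg ?_
    rintro ⟨-, -, rfl⟩
    obtain ⟨r, hr⟩ := h
    push_cast at hr
    omega
  | succ n ih =>
    obtain ⟨r, hr⟩ := h
    push_cast at hr
    have h1 : Odd ((n : ℤ) + (x - 1) + y) := ⟨r - 1, by omega⟩
    have h2 : Odd ((n : ℤ) + (x + 1) + y) := ⟨r, by omega⟩
    simp [stripWalks, ih h1, ih h2]

/-- Adding a step at the start or at the end of a walk gives the same count: a discrete wave
equation in the two endpoints. -/
lemma stripWalks_wave {a b y : ℤ} (hy : a ≤ y ∧ y ≤ b) (n : ℕ) {x : ℤ} (hx : a ≤ x ∧ x ≤ b) :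
    stripWalks a b n (x - 1) y + stripWalks a b n (x + 1) y =
      stripWalks a b n x (y - 1) + stripWalks a b n x (y + 1) := by
  induction n generalizing x with
  | zero =>
    simp only [stripWalks]
    split_ifs <;> omega
  | succ n ih =>
    have key (z : ℤ) : stripWalks a b (n + 1) z y =
        stripWalks a b n z (y - 1) + stripWalks a b n z (y + 1) := by
      by_cases hz : a ≤ z ∧ z ≤ b
      · rw [stripWalks, if_pos hz, ih hz]
      · simp [stripWalks_eq_zero_left hz]
    rw [key, key, stripWalks, stripWalks, if_pos hx, if_pos hx]
    ring

/-- Solving the wave equation with zero boundary values. -/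
lemma stripWalks_eq_sum (b : ℤ) (n j : ℕ) (m : ℤ) (hjm : (j : ℤ) ≤ m + 1)
    (hb : j + m ≤ b + 2) :
    stripWalks 0 b n (j - 1) m =
      ∑ i ∈ Finset.range j, stripWalks 0 b n 0 (m - j + 1 + 2 * i) := by
  induction j using Nat.twoStepInduction generalizing m with
  | zero => simp [stripWalks_eq_zero_left]
  | one => simp
  | more j ih0 ih1 =>
    push_cast at hjm hb ⊢
    have hw := stripWalks_wave (a := 0) (b := b) (y := m) (by omega) n (x := j) (by omega)
    have h0 := ih0 m (by omega) (by omega)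
    have h1 := ih1 (m + 1) (by push_cast; omega) (by push_cast; omega)
    have h2 := ih1 (m - 1) (by push_cast; omega) (by push_cast; omega)
    push_cast at h1 h2
    rw [Finset.sum_range_succ] at h1
    rw [Finset.sum_range_succ]
    have e1 : ∀ i : ℕ, m + 1 - ((j : ℤ) + 1) + 1 + 2 * i = m - j + 1 + 2 * i := fun i => by ring
    have e2 : ∀ i : ℕ, m - 1 - ((j : ℤ) + 1) + 1 + 2 * i = m - (j + 2) + 1 + 2 * i :=
      fun i => by ring
    have e3 : m - ((j : ℤ) + 2) + 1 + 2 * ((j + 1 : ℕ) : ℤ) = m - j + 1 + 2 * j := by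
      push_cast; ring
    have e4 : (j : ℤ) + 1 - 1 = j := by ring
    have e5 : (j : ℤ) + 2 - 1 = j + 1 := by ring
    simp only [e1, e4] at h1
    simp only [e2, e4] at h2
    rw [e3, e5]
    omega

theorem stmt_2 (n k : ℕ) (hk : 1 ≤ k) :
    pathCount (2 * n) (-(k : ℤ) - 1) (k : ℤ) ({0} : Set ℤ)
      = pathCount (2 * n) 0 (2 * k + 1 : ℤ) Set.univ := by
  have hleft : (Finset.Icc (-(k : ℤ) - 1) k).filter (· ∈ ({0} : Set ℤ)) = {0} := by
    ext y
    simp only [Finset.mem_filter, Finset.mem_Icc, Set.mem_singleton_iff, Finset.mem_singleton]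
    omega
  have hsum := stripWalks_eq_sum (2 * k + 1) (2 * n) (k + 2) (k + 1) (by push_cast; omega)
    (by push_cast; omega)
  have hshift := stripWalks_add (-(k : ℤ) - 1) k (k + 1) (2 * n) 0 0
  have e1 : -(k : ℤ) - 1 + (k + 1) = 0 := by ring
  have e2 : (k : ℤ) + (k + 1) = 2 * k + 1 := by ring
  have e3 : ((k + 2 : ℕ) : ℤ) - 1 = k + 1 := by push_cast; ring
  have e4 (i : ℕ) : (k : ℤ) + 1 - (k + 2 : ℕ) + 1 + 2 * i = 2 * i := by push_cast; ring
  rw [e1, e2, zero_add] at hshift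
  simp only [e3, e4] at hsum
  rw [pathCount_eq_sum_stripWalks, pathCount_eq_sum_stripWalks, hleft, Finset.sum_singleton,
    ← hshift, hsum, Finset.sum_range_succ,
    stripWalks_eq_zero_right (y := 2 * ((k + 1 : ℕ) : ℤ)) (by push_cast; omega), add_zero]
  simp only [Set.mem_univ, Finset.filter_true]
  refine Finset.sum_of_injOn (fun i : ℕ => 2 * (i : ℤ)) ?_ ?_ ?_ fun _ _ => rfl
  · intro i _ j _ h
    simpa using h
  · intro i hi
    simp only [Finset.coe_range, Set.mem_Iio, Finset.coe_Icc, Set.mem_Icc] at hi ⊢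
    omega
  · intro y hy hne
    rw [Finset.mem_Icc] at hy
    apply stripWalks_eq_zero_of_odd
    rcases Int.even_or_odd' y with ⟨r, rfl | rfl⟩
    · refine absurd ⟨r.toNat, ?_, ?_⟩ hne
      · simp only [Finset.coe_range, Set.mem_Iio]
        omega
      · simp only
        omega
    · exact ⟨n + r, by push_cast; ring⟩
end

section
/- For every integer n ≥ 0, the number of lattice paths of length 2n that stay in the strip [0, 3] and end at height 2 equals the Fibonacci number F(2n). -/
theorem pathHeight_snoc_of_le {n j : ℕ} (s : Fin n → ℤ) (x : ℤ) (hj : j ≤ n) :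
    pathHeight (Fin.snoc s x : Fin (n + 1) → ℤ) j = pathHeight s j := by
  simp [pathHeight, Finset.sum_filter, Fin.sum_univ_castSucc, hj]

theorem pathHeight_snoc_last {n : ℕ} (s : Fin n → ℤ) (x : ℤ) :
    pathHeight (Fin.snoc s x : Fin (n + 1) → ℤ) (n + 1) = pathHeight s n + x := by
  simp [pathHeight, Finset.sum_filter, Fin.sum_univ_castSucc]

/-- The lattice paths of length `n` staying in `[a, b]` and ending at height `m`. -/
def pathSet (n : ℕ) (a b m : ℤ) : Set (Fin n → ℤ) :=
  {s | (∀ i, s i ∈ ({1, -1} : Set ℤ)) ∧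
    (∀ j ≤ n, pathHeight s j ∈ Set.Icc a b) ∧ pathHeight s n ∈ ({m} : Set ℤ)}

theorem pathCount_singleton (n : ℕ) (a b m : ℤ) :
    pathCount n a b {m} = (pathSet n a b m).ncard :=
  rfl

theorem pathSet_finite (n : ℕ) (a b m : ℤ) : (pathSet n a b m).Finite :=
  (Set.Finite.pi' fun _ : Fin n => Set.toFinite ({1, -1} : Set ℤ)).subset fun _ hs => hs.1

theorem snoc_mem_pathSet_iff {n : ℕ} {a b m : ℤ} (hm : m ∈ Set.Icc a b) (s : Fin n → ℤ) (x : ℤ) :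
    (Fin.snoc s x : Fin (n + 1) → ℤ) ∈ pathSet (n + 1) a b m ↔
      x ∈ ({1, -1} : Set ℤ) ∧ s ∈ pathSet n a b (m - x) := by
  simp only [pathSet, Set.mem_ofPred_eq, Fin.forall_fin_succ', Fin.snoc_castSucc, Fin.snoc_last,
    pathHeight_snoc_last, Set.mem_singleton_iff, eq_sub_iff_add_eq]
  constructor
  · rintro ⟨⟨hs, hx⟩, hh, he⟩
    exact ⟨hx, hs, fun j hj => pathHeight_snoc_of_le s x hj ▸ hh j (by omega), he⟩
  · rintro ⟨hx, hs, hh, he⟩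
    refine ⟨⟨hs, hx⟩, fun j hj => ?_, he⟩
    rcases Nat.le_succ_iff.1 hj with hj | rfl
    · exact (pathHeight_snoc_of_le s x hj).symm ▸ hh j hj
    · rwa [Nat.succ_eq_add_one, pathHeight_snoc_last, he]

theorem pathSet_succ {n : ℕ} {a b m : ℤ} (hm : m ∈ Set.Icc a b) :
    pathSet (n + 1) a b m =
      (fun s => (Fin.snoc s 1 : Fin (n + 1) → ℤ)) '' pathSet n a b (m - 1) ∪
      (fun s => (Fin.snoc s (-1) : Fin (n + 1) → ℤ)) '' pathSet n a b (m + 1) := by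
  ext t
  constructor
  · intro ht
    rw [← Fin.snoc_init_self t, snoc_mem_pathSet_iff hm] at ht
    obtain ⟨hx | hx, hs⟩ := ht
    · exact .inl ⟨Fin.init t, by rwa [hx] at hs, by simp only [← hx, Fin.snoc_init_self]⟩
    · rw [Set.mem_singleton_iff] at hx
      exact .inr ⟨Fin.init t, by rwa [hx, sub_neg_eq_add] at hs,
        by simp only [← hx, Fin.snoc_init_self]⟩
  · rintro (⟨s, hs, rfl⟩ | ⟨s, hs, rfl⟩)
    · exact (snoc_mem_pathSet_iff hm s 1).2 ⟨by simp, hs⟩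
    · exact (snoc_mem_pathSet_iff hm s (-1)).2 ⟨by simp, by rwa [sub_neg_eq_add]⟩

theorem pathCount_succ {n : ℕ} {a b m : ℤ} (hm : m ∈ Set.Icc a b) :
    pathCount (n + 1) a b {m} = pathCount n a b {m - 1} + pathCount n a b {m + 1} := by
  have hinj (x : ℤ) : Function.Injective (fun s : Fin n → ℤ => (Fin.snoc s x : Fin (n + 1) → ℤ)) :=
    fun s t h => (Fin.snoc_injective2 h).1
  simp only [pathCount_singleton]
  rw [pathSet_succ hm, Set.ncard_union_eq _ ((pathSet_finite ..).image _)
    ((pathSet_finite ..).image _), Set.ncard_image_of_injective _ (hinj 1),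
    Set.ncard_image_of_injective _ (hinj (-1))]
  rw [Set.disjoint_left]
  rintro _ ⟨s, -, rfl⟩ ⟨t, -, h⟩
  have := (Fin.snoc_injective2 h).2
  omega

theorem pathCount_eq_zero_of_notMem {n : ℕ} {a b m : ℤ} (hm : m ∉ Set.Icc a b) :
    pathCount n a b {m} = 0 := by
  rw [pathCount_singleton, Set.ncard_eq_zero (pathSet_finite ..), Set.eq_empty_iff_forall_notMem]
  rintro s ⟨-, hh, he⟩
  exact hm (Set.mem_singleton_iff.1 he ▸ hh n le_rfl)

theorem pathCount_zero_of_ne {a b m : ℤ} (hm : m ≠ 0) : pathCount 0 a b {m} = 0 := by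
  rw [pathCount_singleton, Set.ncard_eq_zero (pathSet_finite ..), Set.eq_empty_iff_forall_notMem]
  rintro s ⟨-, -, he⟩
  exact hm (by simpa [pathHeight] using he.symm)

theorem pathCount_zero_zero {a b : ℤ} (h : (0 : ℤ) ∈ Set.Icc a b) : pathCount 0 a b {0} = 1 := by
  rw [pathCount_singleton, Set.ncard_eq_one]
  refine ⟨0, Set.eq_singleton_iff_unique_mem.2 ⟨?_, fun _ _ => Subsingleton.elim _ _⟩⟩
  simpa [pathSet, pathHeight] using h

theorem pathCount_strip_three (n : ℕ) :
    pathCount (2 * n) 0 3 {2} = Nat.fib (2 * n) ∧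
      pathCount (2 * n) 0 3 {0} + Nat.fib (2 * n) = Nat.fib (2 * n + 1) := by
  induction n with
  | zero => simp [pathCount_zero_of_ne, pathCount_zero_zero]
  | succ n ih =>
    have hneg (k : ℕ) : pathCount k 0 3 {-1} = 0 := pathCount_eq_zero_of_notMem (by simp)
    have hfour (k : ℕ) : pathCount k 0 3 {4} = 0 := pathCount_eq_zero_of_notMem (by simp)
    have h0 (k : ℕ) := pathCount_succ (n := k) (show (0 : ℤ) ∈ Set.Icc 0 3 by simp)
    have h1 (k : ℕ) := pathCount_succ (n := k) (show (1 : ℤ) ∈ Set.Icc 0 3 by simp)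
    have h2 (k : ℕ) := pathCount_succ (n := k) (show (2 : ℤ) ∈ Set.Icc 0 3 by simp)
    have h3 (k : ℕ) := pathCount_succ (n := k) (show (3 : ℤ) ∈ Set.Icc 0 3 by simp)
    norm_num only [hneg, hfour] at h0 h1 h2 h3
    have f2 : Nat.fib (2 * n + 1 + 1) = Nat.fib (2 * n) + Nat.fib (2 * n + 1) := Nat.fib_add_two
    have f3 : Nat.fib (2 * n + 1 + 1 + 1) = Nat.fib (2 * n + 1) + Nat.fib (2 * n + 1 + 1) :=
      Nat.fib_add_two
    rw [show 2 * (n + 1) = 2 * n + 1 + 1 by ring, h2, h0, h1, h3]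
    omega

theorem stmt_11 (n : ℕ) :
    pathCount (2 * n) 0 3 ({2} : Set ℤ) = Nat.fib (2 * n) := by
  exact (pathCount_strip_three n).1
end
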